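/- For every a ∈ {0,1}^n, the linear inequality ⟨2·diag(a) − aaᵀ, x⟩ ≤ 1 (Frobenius inner product) is valid for all x ∈ COR(n); moreover, for every vertex x = bbᵀ with b ∈ {0,1}^n, the slack equals 1 − ⟨2·diag(a) − aaᵀ, bbᵀ⟩ = (1 − aᵀb)². In particular, the unique disjointness matrix UDISJ(n) is a submatrix of the slack matrix of COR(n). -/

import Mathlib

/-- The real 0/1 vector associated to a bit string. -/
def bitVec {n : ℕ} (a : Fin n → Bool) : Fin n → ℝ := fun i => if a i then 1 else 0

/-- The correlation polytope `COR(n) = conv{ bbᵀ : b ∈ {0,1}ⁿ } ⊆ ℝ^{n×n}`. -/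
noncomputable def COR (n : ℕ) : Set (Matrix (Fin n) (Fin n) ℝ) :=
  convexHull ℝ {X | ∃ b : Fin n → Bool, X = Matrix.vecMulVec (bitVec b) (bitVec b)}

/-- The Frobenius inner product `⟨A, X⟩ = Σᵢⱼ Aᵢⱼ Xᵢⱼ = Tr(AᵀX)`. -/
def frob {n : ℕ} (A X : Matrix (Fin n) (Fin n) ℝ) : ℝ := ∑ i, ∑ j, A i j * X i j

theorem bitVec_mul_self {n : ℕ} (b : Fin n → Bool) (i : Fin n) :
    bitVec b i * bitVec b i = bitVec b i := by
  simp [bitVec]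

theorem isLinearMap_frob {n : ℕ} (A : Matrix (Fin n) (Fin n) ℝ) : IsLinearMap ℝ (frob A) where
  map_add X Y := by simp [frob, mul_add, Finset.sum_add_distrib]
  map_smul c X := by simp [frob, Finset.mul_sum, mul_left_comm]

theorem frob_sub_left {n : ℕ} (A B X : Matrix (Fin n) (Fin n) ℝ) :
    frob (A - B) X = frob A X - frob B X := by
  simp [frob, sub_mul, Finset.sum_sub_distrib]

theorem frob_two_smul_diagonal {n : ℕ} (v : Fin n → ℝ) (X : Matrix (Fin n) (Fin n) ℝ) :
    frob (2 • Matrix.diagonal v) X = 2 * ∑ i, v i * X i i := by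
  simp [frob, Matrix.diagonal_apply, Finset.mul_sum, mul_assoc]

theorem frob_vecMulVec_self {n : ℕ} (v w : Fin n → ℝ) :
    frob (Matrix.vecMulVec v v) (Matrix.vecMulVec w w) = (∑ i, v i * w i) ^ 2 := by
  rw [sq, Finset.sum_mul_sum]
  simp only [frob, Matrix.vecMulVec_apply, mul_mul_mul_comm]

theorem one_sub_frob_vecMulVec_bitVec {n : ℕ} (a b : Fin n → Bool) :
    1 - frob (2 • Matrix.diagonal (bitVec a) - Matrix.vecMulVec (bitVec a) (bitVec a))
          (Matrix.vecMulVec (bitVec b) (bitVec b))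
      = (1 - ∑ i, bitVec a i * bitVec b i) ^ 2 := by
  rw [frob_sub_left, frob_two_smul_diagonal, frob_vecMulVec_self]
  simp only [Matrix.vecMulVec_apply, bitVec_mul_self]
  ring

/-- For every `a ∈ {0,1}ⁿ`, the inequality `⟨2·diag(a) - aaᵀ, x⟩ ≤ 1` is valid on the
correlation polytope `COR(n)`; moreover at each vertex `x = bbᵀ` (`b ∈ {0,1}ⁿ`) the slack
equals `1 - ⟨2·diag(a) - aaᵀ, bbᵀ⟩ = (1 - aᵀb)²`.  (In particular `UDISJ(n)` is a
submatrix of the slack matrix of `COR(n)`.) -/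
theorem cor_valid_inequality_slack (n : ℕ) (a : Fin n → Bool) :
    (∀ X ∈ COR n,
      frob (2 • Matrix.diagonal (bitVec a) - Matrix.vecMulVec (bitVec a) (bitVec a)) X ≤ 1) ∧
    (∀ b : Fin n → Bool,
      1 - frob (2 • Matrix.diagonal (bitVec a) - Matrix.vecMulVec (bitVec a) (bitVec a))
            (Matrix.vecMulVec (bitVec b) (bitVec b))
        = (1 - ∑ i, bitVec a i * bitVec b i) ^ 2) := by
  refine ⟨fun X hX => ?_, one_sub_frob_vecMulVec_bitVec a⟩
  refine convexHull_min ?_ (convex_halfSpace_le (isLinearMap_frob _) 1) hX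
  rintro _ ⟨b, rfl⟩
  rw [Set.mem_ofPred_eq, ← sub_nonneg, one_sub_frob_vecMulVec_bitVec]
  exact sq_nonneg _
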